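/- (Domination by the unwrapped process, inequality (domi) of the paper.) Fix μ ∈ (0,1/2], n ≥ 2, and a sequence of edge indices (v_k)_{k∈ℕ} in {1,…,n−1}. Let (η_k)_{k∈ℕ} be configurations η_k : {1,…,n} → S with η_{k+1} obtained from η_k by a μ-compromise at the edge e_{v_k}, and let (ξ_k)_{k∈ℕ}, ξ_k : {1,…,n−1} → ℝ, evolve by the linear rule ξ_{k+1}(v_k) = (1−2μ)ξ_k(v_k), ξ_{k+1}(u) = ξ_k(u) + μ ξ_k(v_k) for u ∈ {v_k−1, v_k+1} ∩ {1,…,n−1}, and ξ_{k+1}(u) = ξ_k(u) for all other u. If ξ_0(u) ≥ ‖η_0(u+1) − η_0(u)‖ for every u ∈ {1,…,n−1}, then ξ_k(u) ≥ ‖η_k(u+1) − η_k(u)‖ for every k ∈ ℕ and every u ∈ {1,…,n−1}. -/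

import Mathlib

open Filter Topology MeasureTheory
open scoped BigOperators

noncomputable section

instance : Fact ((0:ℝ) < 2) := ⟨by norm_num⟩

/-- The circle opinion space `S = ℝ/2ℤ`. -/
abbrev S := AddCircle (2 : ℝ)

/-- `(x', y')` is a `μ`-compromise of `(x, y)`: there are real representatives `a, b`
with `|a - b| ≤ 1` such that the updated opinions are obtained by moving a fraction `μ`
towards each other along the corresponding geodesic. -/
def IsCompromise (μ : ℝ) (x y x' y' : S) : Prop :=
  ∃ a b : ℝ, (a : S) = x ∧ (b : S) = y ∧ |a - b| ≤ 1 ∧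
    x' = ((a + μ * (b - a) : ℝ) : S) ∧ y' = ((b + μ * (a - b) : ℝ) : S)

/-- `η'` is obtained from `η` by a `μ`-compromise at the edge `e_v = ⟨v, v+1⟩` of the
path `P_n` with vertex set `{1, …, n}` (so `1 ≤ v ≤ n - 1`). -/
def UpdateAt (μ : ℝ) (n v : ℕ) (η η' : ℕ → S) : Prop :=
  1 ≤ v ∧ v + 1 ≤ n ∧ IsCompromise μ (η v) (η (v+1)) (η' v) (η' (v+1)) ∧
    ∀ u, u ≠ v → u ≠ v + 1 → η' u = η u

/-- The linear (unwrapped) edge-difference update of the compass model on the path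
`P_n`: an update at edge `e_v` multiplies the value at `e_v` by `1 - 2μ` and adds `μ`
times the old value at `e_v` to the values at the neighboring edges
`e_{v-1}, e_{v+1}` (where these exist, i.e. within `{1, …, n-1}`). -/
def linUpdate (μ : ℝ) (n v : ℕ) (ξ : ℕ → ℝ) : ℕ → ℝ := fun u =>
  if u = v then (1 - 2*μ) * ξ v
  else if (u + 1 = v ∨ u = v + 1) ∧ 1 ≤ u ∧ u ≤ n - 1 then ξ u + μ * ξ v
  else ξ u

/-- The quotient norm of a real class is at most the absolute value of a representative. -/
lemma norm_coe_le_abs (x : ℝ) : ‖(x : S)‖ ≤ |x| :=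
  QuotientAddGroup.norm_mk_le_norm

/-- A `μ`-compromise shrinks the distance by `1 - 2μ` and moves each opinion by at most
`μ` times the old distance. -/
lemma IsCompromise.norm_bounds {μ : ℝ} (hμ : μ ∈ Set.Ioc (0:ℝ) (1/2)) {x y x' y' : S}
    (h : IsCompromise μ x y x' y') :
    ‖y' - x'‖ ≤ (1 - 2*μ) * ‖y - x‖ ∧ ‖x' - x‖ ≤ μ * ‖y - x‖ ∧
      ‖y - y'‖ ≤ μ * ‖y - x‖ := by
  obtain ⟨hμ0, hμ1⟩ := hμ
  obtain ⟨a, b, rfl, rfl, hab, rfl, rfl⟩ := h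
  have hD : ‖(b : S) - (a : S)‖ = |b - a| := by
    rw [← AddCircle.coe_sub]
    refine (AddCircle.norm_coe_eq_abs_iff 2 two_ne_zero).2 ?_
    rw [abs_sub_comm]
    norm_num [hab]
  have hmove : |μ * (b - a)| = μ * |b - a| := by rw [abs_mul, abs_of_pos hμ0]
  rw [hD]
  refine ⟨?_, ?_, ?_⟩
  · rw [← AddCircle.coe_sub]
    refine (norm_coe_le_abs _).trans_eq ?_
    rw [show b + μ * (a - b) - (a + μ * (b - a)) = (1 - 2*μ) * (b - a) by ring, abs_mul,
      abs_of_nonneg (by linarith)]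
  · rw [← AddCircle.coe_sub, ← hmove]
    refine (norm_coe_le_abs _).trans_eq ?_
    ring_nf
  · rw [← AddCircle.coe_sub, ← hmove]
    refine (norm_coe_le_abs _).trans_eq ?_
    ring_nf

/-- One update preserves the domination of the edge differences. -/
lemma UpdateAt.norm_le_linUpdate {μ : ℝ} (hμ : μ ∈ Set.Ioc (0:ℝ) (1/2)) {n v : ℕ}
    {η η' : ℕ → S} {ξ : ℕ → ℝ} (h : UpdateAt μ n v η η')
    (hξ : ∀ u ∈ Finset.Icc 1 (n-1), ‖η (u+1) - η u‖ ≤ ξ u) :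
    ∀ u ∈ Finset.Icc 1 (n-1), ‖η' (u+1) - η' u‖ ≤ linUpdate μ n v ξ u := by
  intro u hu
  obtain ⟨hv1, hvn, hc, hrest⟩ := h
  obtain ⟨hdiff, hleft, hright⟩ := hc.norm_bounds hμ
  have hv := hξ v (Finset.mem_Icc.2 ⟨hv1, by omega⟩)
  have hmove := mul_le_mul_of_nonneg_left hv hμ.1.le
  have hu' := Finset.mem_Icc.1 hu
  have hold := hξ u hu
  unfold linUpdate
  split_ifs with huv hadj
  · subst huv
    exact hdiff.trans (mul_le_mul_of_nonneg_left hv (by linarith [hμ.2]))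
  · rcases hadj.1 with rfl | rfl
    · rw [hrest u (by omega) (by omega)]
      linarith [norm_sub_le_norm_sub_add_norm_sub (η' (u+1)) (η (u+1)) (η u)]
    · rw [hrest (v+1+1) (by omega) (by omega)]
      linarith [norm_sub_le_norm_sub_add_norm_sub (η (v+1+1)) (η (v+1)) (η' (v+1))]
  · rw [hrest u huv (by omega), hrest (u+1) (by omega) (by omega)]
    exact hold

/-- Inequality (domi): the unwrapped linear edge-difference process dominates the true
edge-difference norms of the compass model on the path `P_n`, for any common update
sequence, as soon as it does so initially. -/
theorem unwrapped_domination (μ : ℝ) (hμ : μ ∈ Set.Ioc (0:ℝ) (1/2)) (n : ℕ)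
    (hn : 2 ≤ n) (v : ℕ → ℕ) (η : ℕ → ℕ → S) (ξ : ℕ → ℕ → ℝ)
    (hη : ∀ k, UpdateAt μ n (v k) (η k) (η (k+1)))
    (hξ : ∀ k, ξ (k+1) = linUpdate μ n (v k) (ξ k))
    (h0 : ∀ u ∈ Finset.Icc 1 (n-1), ‖η 0 (u+1) - η 0 u‖ ≤ ξ 0 u) :
    ∀ k, ∀ u ∈ Finset.Icc 1 (n-1), ‖η k (u+1) - η k u‖ ≤ ξ k u := by
  intro k
  induction k with
  | zero => exact h0
  | succ k ih =>
    rw [hξ k]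
    exact (hη k).norm_le_linUpdate hμ ih
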